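/- Let p > 1 and a, b > 0, and let w = (b/a) · Z(p−2,a,b)/Z(p,a,b). Then for every x > 0, f_{p,a,b}(x) = ∫₀^x (a/2) · exp(−(a/2)(x−y)) · [ w · f_{p−2,a,b}(y) + (1−w) · f_{p−1,a,b}(y) ] dy. (This is the convolution identity of Proposition 4: if Y has density w f_{p−2,a,b} + (1−w) f_{p−1,a,b} and E is an independent Exponential(a/2) random variable, then Y + E has the GIG(p,a,b) distribution.) -/

import Mathlib

open Real MeasureTheory Set

/-- The (unnormalized) kernel of the GIG(p,a,b) distribution. -/
noncomputable def gigKernel (p a b x : ℝ) : ℝ :=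
  x ^ (p - 1) * Real.exp (-((a * x + b / x) / 2))

/-- The normalizing constant Z(p,a,b) of the GIG(p,a,b) distribution. -/
noncomputable def gigZ (p a b : ℝ) : ℝ :=
  ∫ x in Ioi (0 : ℝ), gigKernel p a b x

/-- The probability density function of the GIG(p,a,b) distribution. -/
noncomputable def gigPdf (p a b x : ℝ) : ℝ :=
  gigKernel p a b x / gigZ p a b

/-- The inverse Gaussian InvGauss(μ,λ) density. -/
noncomputable def invGaussPdf (μ lam x : ℝ) : ℝ :=
  Real.sqrt (lam / (2 * Real.pi * x ^ 3)) *
    Real.exp (-(lam * (x - μ) ^ 2) / (2 * μ ^ 2 * x))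

/-- The Gamma(α,β) density (shape α, rate β). -/
noncomputable def gammaPdf (α β y : ℝ) : ℝ :=
  β ^ α * y ^ (α - 1) * Real.exp (-(β * y)) / Real.Gamma α

/-- A GIG kernel with `b ≥ 0` is dominated by the Gamma-type kernel with the same `p` and `a`. -/
lemma gigKernel_le_rpow_mul_exp {p a b x : ℝ} (hb : 0 ≤ b) (hx : 0 ≤ x) :
    gigKernel p a b x ≤ x ^ (p - 1) * Real.exp (-(a / 2) * x) := by
  unfold gigKernel
  have : 0 ≤ b / x := div_nonneg hb hx
  gcongr
  linarith

lemma gigKernel_pos (p a b : ℝ) {x : ℝ} (hx : 0 < x) : 0 < gigKernel p a b x := by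
  unfold gigKernel
  positivity

lemma gigKernel_nonneg (p a b : ℝ) {x : ℝ} (hx : 0 ≤ x) : 0 ≤ gigKernel p a b x := by
  unfold gigKernel
  positivity

lemma hasDerivAt_gigKernel (p a b : ℝ) {x : ℝ} (hx : 0 < x) :
    HasDerivAt (gigKernel p a b)
      ((p - 1) * gigKernel (p - 1) a b x - a / 2 * gigKernel p a b x
        + b / 2 * gigKernel (p - 2) a b x) x := by
  have h1 : HasDerivAt (fun y : ℝ => y ^ (p - 1)) ((p - 1) * x ^ (p - 1 - 1)) x :=
    Real.hasDerivAt_rpow_const (Or.inl hx.ne')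
  have h2 : HasDerivAt (fun y : ℝ => -((a * y + b * y⁻¹) / 2))
      (-((a * 1 + b * -(x ^ 2)⁻¹) / 2)) x :=
    ((((hasDerivAt_id x).const_mul a).add ((hasDerivAt_inv hx.ne').const_mul b)).div_const 2).neg
  have e : x ^ (p - 2 - 1) = x ^ (p - 1) * (x ^ 2)⁻¹ := by
    rw [← Real.rpow_natCast x 2, ← Real.rpow_neg hx.le, ← Real.rpow_add hx]
    congr 1
    push_cast
    ring
  have hval : (p - 1) * gigKernel (p - 1) a b x - a / 2 * gigKernel p a b x
        + b / 2 * gigKernel (p - 2) a b x =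
      (p - 1) * x ^ (p - 1 - 1) * Real.exp (-((a * x + b * x⁻¹) / 2)) +
        x ^ (p - 1) * (Real.exp (-((a * x + b * x⁻¹) / 2)) *
          -((a * 1 + b * -(x ^ 2)⁻¹) / 2)) := by
    simp only [gigKernel, e, div_eq_mul_inv]
    ring
  rw [hval]
  exact h1.mul h2.exp

lemma continuousOn_gigKernel (p a b : ℝ) : ContinuousOn (gigKernel p a b) (Ioi 0) :=
  fun _ hx => (hasDerivAt_gigKernel p a b hx).continuousAt.continuousWithinAt

lemma continuousWithinAt_gigKernel_zero {p a b : ℝ} (hp : 1 < p) (hb : 0 ≤ b) :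
    ContinuousWithinAt (gigKernel p a b) (Ici 0) 0 := by
  have hp' : 0 < p - 1 := sub_pos.2 hp
  have h0 : gigKernel p a b 0 = 0 := by
    simp [gigKernel, Real.zero_rpow hp'.ne']
  have hc : Continuous fun x : ℝ => x ^ (p - 1) * Real.exp (-(a / 2) * x) :=
    (Real.continuous_rpow_const hp'.le).mul (by fun_prop)
  have hlim : Filter.Tendsto (fun x : ℝ => x ^ (p - 1) * Real.exp (-(a / 2) * x))
      (nhdsWithin 0 (Ici 0)) (nhds 0) := by
    have := (hc.tendsto 0).mono_left (nhdsWithin_le_nhds (s := Ici 0))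
    simpa [Real.zero_rpow hp'.ne'] using this
  rw [ContinuousWithinAt, h0]
  refine tendsto_of_tendsto_of_tendsto_of_le_of_le' tendsto_const_nhds hlim ?_ ?_
  · filter_upwards [self_mem_nhdsWithin] with x hx using gigKernel_nonneg p a b hx
  · filter_upwards [self_mem_nhdsWithin] with x hx using gigKernel_le_rpow_mul_exp hb hx

lemma tendsto_gigKernel_atTop (p : ℝ) {a b : ℝ} (ha : 0 < a) (hb : 0 ≤ b) :
    Filter.Tendsto (gigKernel p a b) Filter.atTop (nhds 0) := by
  refine tendsto_of_tendsto_of_tendsto_of_le_of_le' tendsto_const_nhds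
    (tendsto_rpow_mul_exp_neg_mul_atTop_nhds_zero (p - 1) (a / 2) (half_pos ha)) ?_ ?_
  · filter_upwards [Filter.eventually_ge_atTop 0] with x hx using gigKernel_nonneg p a b hx
  · filter_upwards [Filter.eventually_ge_atTop 0] with x hx using gigKernel_le_rpow_mul_exp hb hx

lemma integrableOn_gigKernel_of_le {p a b C q : ℝ} (ha : 0 < a) (hq : -1 < q)
    (h : ∀ x, 0 < x → gigKernel p a b x ≤ C * (x ^ q * Real.exp (-(a / 2) * x))) :
    IntegrableOn (gigKernel p a b) (Ioi 0) := by
  have hg : IntegrableOn (fun x : ℝ => x ^ q * Real.exp (-(a / 2) * x)) (Ioi 0) := by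
    simpa using integrableOn_rpow_mul_exp_neg_mul_rpow hq one_pos (half_pos ha)
  refine (hg.const_mul C).mono'
    ((continuousOn_gigKernel p a b).aestronglyMeasurable measurableSet_Ioi) ?_
  filter_upwards [ae_restrict_mem measurableSet_Ioi] with x hx
  rw [Real.norm_of_nonneg (gigKernel_pos p a b hx).le]
  exact h x hx

lemma integrableOn_gigKernel_of_pos {p a b : ℝ} (hp : 0 < p) (ha : 0 < a) (hb : 0 ≤ b) :
    IntegrableOn (gigKernel p a b) (Ioi 0) :=
  integrableOn_gigKernel_of_le (C := 1) (q := p - 1) ha (by linarith) fun x hx => by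
    simpa using gigKernel_le_rpow_mul_exp hb hx.le

lemma integrableOn_gigKernel_of_neg_one_lt {p a b : ℝ} (hp : -1 < p) (ha : 0 < a) (hb : 0 < b) :
    IntegrableOn (gigKernel p a b) (Ioi 0) := by
  refine integrableOn_gigKernel_of_le (C := 2 / b) (q := p) ha hp fun x hx => ?_
  have hexp : Real.exp (-(b / x / 2)) ≤ 2 / b * x := by
    have ht : 0 < b / x / 2 := by positivity
    rw [Real.exp_neg, show 2 / b * x = (b / x / 2)⁻¹ by field_simp]
    exact inv_anti₀ ht ((lt_add_one _).le.trans (Real.add_one_le_exp _))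
  have hsplit : gigKernel p a b x =
      x ^ (p - 1) * Real.exp (-(a / 2) * x) * Real.exp (-(b / x / 2)) := by
    rw [gigKernel, mul_assoc, ← Real.exp_add]
    congr 2
    ring
  have hpow : x ^ p = x ^ (p - 1) * x := by
    rw [Real.rpow_sub_one hx.ne', div_mul_cancel₀ _ hx.ne']
  calc gigKernel p a b x
      ≤ x ^ (p - 1) * Real.exp (-(a / 2) * x) * (2 / b * x) := by
        rw [hsplit]
        gcongr
    _ = 2 / b * (x ^ p * Real.exp (-(a / 2) * x)) := by
        rw [hpow]
        ring

lemma gigZ_pos {p a b : ℝ} (h : IntegrableOn (gigKernel p a b) (Ioi 0)) : 0 < gigZ p a b := by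
  rw [gigZ, setIntegral_pos_iff_support_of_nonneg_ae _ h]
  · have hsub : Ioi 0 ⊆ Function.support (gigKernel p a b) := fun x hx =>
      (gigKernel_pos p a b hx).ne'
    simp [inter_eq_right.2 hsub]
  · filter_upwards [ae_restrict_mem measurableSet_Ioi] with x hx
    exact (gigKernel_pos p a b hx).le

/-- The three-term recurrence of the normalizing constants, obtained by integrating the
derivative of the kernel over `(0, ∞)`. -/
lemma gigZ_recurrence {p a b : ℝ} (hp : 1 < p) (ha : 0 < a) (hb : 0 < b) :
    (p - 1) * gigZ (p - 1) a b - a / 2 * gigZ p a b + b / 2 * gigZ (p - 2) a b = 0 := by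
  have i0 := (integrableOn_gigKernel_of_pos (p := p) (by linarith) ha hb.le).const_mul (a / 2)
  have i1 := (integrableOn_gigKernel_of_pos (p := p - 1) (by linarith) ha hb.le).const_mul (p - 1)
  have i2 := (integrableOn_gigKernel_of_neg_one_lt (p := p - 2) (by linarith) ha hb).const_mul
    (b / 2)
  have i10 : IntegrableOn (fun x => (p - 1) * gigKernel (p - 1) a b x - a / 2 * gigKernel p a b x)
      (Ioi 0) := i1.sub i0
  have h := integral_Ioi_of_hasDerivAt_of_tendsto (continuousWithinAt_gigKernel_zero hp hb.le)
    (fun x hx => hasDerivAt_gigKernel p a b hx) (i10.add i2)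
    (tendsto_gigKernel_atTop p ha hb.le)
  rw [integral_add i10 i2, integral_sub i1 i0, integral_const_mul, integral_const_mul,
    integral_const_mul] at h
  simpa [gigZ, gigKernel, Real.zero_rpow (sub_pos.2 hp).ne'] using h

lemma gigKernel_eq_exp_mul (p a b x : ℝ) :
    gigKernel p a b x = Real.exp (-(a / 2) * x) * gigKernel p 0 b x := by
  rw [gigKernel, gigKernel, mul_left_comm, ← Real.exp_add]
  congr 2
  ring

/-- The fundamental theorem of calculus for the kernel with `a = 0`. -/
lemma setIntegral_deriv_gigKernel_zero {p b x : ℝ} (hp : 1 < p) (hb : 0 ≤ b) (hx : 0 < x) :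
    ∫ y in Ioo 0 x, ((p - 1) * gigKernel (p - 1) 0 b y + b / 2 * gigKernel (p - 2) 0 b y)
      = gigKernel p 0 b x := by
  have hcont : ContinuousOn (gigKernel p 0 b) (Icc 0 x) := by
    intro y hy
    rcases hy.1.eq_or_lt with rfl | h
    · exact (continuousWithinAt_gigKernel_zero hp hb).mono Icc_subset_Ici_self
    · exact (hasDerivAt_gigKernel p 0 b h).continuousAt.continuousWithinAt
  have hderiv : ∀ y ∈ Ioo 0 x, HasDerivAt (gigKernel p 0 b)
      ((p - 1) * gigKernel (p - 1) 0 b y + b / 2 * gigKernel (p - 2) 0 b y) y := fun y hy => by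
    simpa using hasDerivAt_gigKernel p 0 b hy.1
  have hint := intervalIntegral.integrableOn_deriv_of_nonneg hcont hderiv fun y hy =>
    add_nonneg (mul_nonneg (sub_pos.2 hp).le (gigKernel_pos _ _ _ hy.1).le)
      (mul_nonneg (div_nonneg hb zero_le_two) (gigKernel_pos _ _ _ hy.1).le)
  have h := intervalIntegral.integral_eq_sub_of_hasDerivAt_of_le hx.le hcont hderiv
    ((intervalIntegrable_iff_integrableOn_Ioc_of_le hx.le).2 hint)
  rw [intervalIntegral.integral_of_le hx.le, integral_Ioc_eq_integral_Ioo] at h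
  rw [h]
  simp [gigKernel, Real.zero_rpow (sub_pos.2 hp).ne']

/-- Proposition 4 (convolution identity): for p > 1, the GIG(p,a,b) density is the
convolution of the two-component GIG mixture density with the Exponential(a/2) density. -/
theorem gig_convolution (p a b : ℝ) (hp : 1 < p) (ha : 0 < a) (hb : 0 < b)
    (w : ℝ) (hw : w = (b / a) * gigZ (p - 2) a b / gigZ p a b)
    (x : ℝ) (hx : 0 < x) :
    gigPdf p a b x =
      ∫ y in Ioo (0 : ℝ) x,
        (a / 2) * Real.exp (-(a / 2) * (x - y)) *
          (w * gigPdf (p - 2) a b y + (1 - w) * gigPdf (p - 1) a b y) := by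
  have z0 := gigZ_pos (integrableOn_gigKernel_of_pos (p := p) (by linarith) ha hb.le)
  have z1 := gigZ_pos (integrableOn_gigKernel_of_pos (p := p - 1) (by linarith) ha hb.le)
  have z2 := gigZ_pos (integrableOn_gigKernel_of_neg_one_lt (p := p - 2) (by linarith) ha hb)
  have hw2 : a / 2 * w / gigZ (p - 2) a b = b / 2 / gigZ p a b := by
    rw [hw]
    field_simp
  have hw1 : a / 2 * (1 - w) / gigZ (p - 1) a b = (p - 1) / gigZ p a b := by
    rw [hw]
    field_simp
    linarith [gigZ_recurrence hp ha hb]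
  have hintegrand : ∀ y, a / 2 * Real.exp (-(a / 2) * (x - y)) *
      (w * gigPdf (p - 2) a b y + (1 - w) * gigPdf (p - 1) a b y) =
      Real.exp (-(a / 2) * x) / gigZ p a b *
        ((p - 1) * gigKernel (p - 1) 0 b y + b / 2 * gigKernel (p - 2) 0 b y) := fun y => by
    have he : Real.exp (-(a / 2) * (x - y)) * Real.exp (-(a / 2) * y) =
        Real.exp (-(a / 2) * x) := by
      rw [← Real.exp_add]
      congr 1
      ring
    rw [gigPdf, gigPdf, gigKernel_eq_exp_mul (p - 2), gigKernel_eq_exp_mul (p - 1), ← he]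
    linear_combination Real.exp (-(a / 2) * (x - y)) * Real.exp (-(a / 2) * y) *
      (gigKernel (p - 2) 0 b y * hw2 + gigKernel (p - 1) 0 b y * hw1)
  simp_rw [hintegrand]
  rw [integral_const_mul, setIntegral_deriv_gigKernel_zero hp hb.le hx, gigPdf,
    gigKernel_eq_exp_mul]
  ring
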